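/- For every integer q ≥ 2, the limit lim_{n→∞} II_n(Z_3, q) exists and equals ∑_{ℓ=1}^∞ a_ℓ · ∑_{i=0}^∞ (G_ℓ(i) + H_ℓ(i)), and all the series involved converge. -/

import Mathlib

/-- `V` is a bifix of `W`: `V` is nonempty and is both a proper prefix
and a proper suffix of `W`. -/
def IsBifix {α : Type*} (V W : List α) : Prop :=
  V ≠ [] ∧ (∃ A, A ≠ [] ∧ W = V ++ A) ∧ (∃ B, B ≠ [] ∧ W = B ++ V)

/-- A word is bifix-free if it has no bifix. -/
def BifixFree {α : Type*} (W : List α) : Prop := ∀ V, ¬ IsBifix V W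

/-- `aCount q ℓ` is the number of bifix-free words of length `ℓ` over a `q`-letter
alphabet, with the convention `aCount q 0 = 0`. -/
noncomputable def aCount (q ℓ : ℕ) : ℕ :=
  if ℓ = 0 then 0 else Nat.card {W : List (Fin q) // W.length = ℓ ∧ BifixFree W}

/-- A word is a `Z₃`-instance if it has the form `ABACABA` with `A, B, C` nonempty. -/
def Z3Instance {α : Type*} (W : List α) : Prop :=
  ∃ A B C : List α, A ≠ [] ∧ B ≠ [] ∧ C ≠ [] ∧
    W = A ++ B ++ A ++ C ++ A ++ B ++ A

/-- `instProb3 q n` is the probability that a uniformly random word of length `n`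
over a `q`-letter alphabet is a `Z₃`-instance. -/
noncomputable def instProb3 (q n : ℕ) : ℝ :=
  (Nat.card {W : List (Fin q) // W.length = n ∧ Z3Instance W} : ℝ) / (q : ℝ) ^ n

/-- `r(x) = qx^{2ℓ+1} − x^{4ℓ} + x^{5ℓ} − qx^{5ℓ+1} + x^{6ℓ}`. -/
noncomputable def rPoly (q ℓ : ℕ) (x : ℝ) : ℝ :=
  q * x ^ (2 * (ℓ : ℤ) + 1) - x ^ (4 * (ℓ : ℤ)) + x ^ (5 * (ℓ : ℤ)) -
    q * x ^ (5 * (ℓ : ℤ) + 1) + x ^ (6 * (ℓ : ℤ))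

/-- `s(x) = 1 − qx^{1−ℓ} + x^{−ℓ}`. -/
noncomputable def sPoly (q ℓ : ℕ) (x : ℝ) : ℝ :=
  1 - q * x ^ (1 - (ℓ : ℤ)) + x ^ (-(ℓ : ℤ))

/-- `u(x) = qx^{4ℓ+1} − x^{5ℓ} + qx^{5ℓ+1} − x^{6ℓ}`. -/
noncomputable def uPoly (q ℓ : ℕ) (x : ℝ) : ℝ :=
  q * x ^ (4 * (ℓ : ℤ) + 1) - x ^ (5 * (ℓ : ℤ)) + q * x ^ (5 * (ℓ : ℤ) + 1) -
    x ^ (6 * (ℓ : ℤ))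

/-- `v(x) = 1 − qx^{1−ℓ} + x^{−ℓ} − qx^{1−2ℓ} + x^{−2ℓ}`. -/
noncomputable def vPoly (q ℓ : ℕ) (x : ℝ) : ℝ :=
  1 - q * x ^ (1 - (ℓ : ℤ)) + x ^ (-(ℓ : ℤ)) - q * x ^ (1 - 2 * (ℓ : ℤ)) +
    x ^ (-(2 * (ℓ : ℤ)))

/-- `G_ℓ(i) = (−1)^i r(q^{−2^{i+1}}) ∏_{j=0}^{i−1} s(q^{−2^{j+1}})
  / ∏_{k=0}^{i} (1 − q^{1−2^{k+1}})`. -/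
noncomputable def Gterm (q ℓ i : ℕ) : ℝ :=
  (-1 : ℝ) ^ i * rPoly q ℓ ((q : ℝ) ^ (-(2 : ℤ) ^ (i + 1))) *
      (∏ j ∈ Finset.range i, sPoly q ℓ ((q : ℝ) ^ (-(2 : ℤ) ^ (j + 1)))) /
    ∏ k ∈ Finset.range (i + 1), (1 - (q : ℝ) ^ ((1 : ℤ) - 2 ^ (k + 1)))

/-- `H_ℓ(i) = (−1)^i u(q^{−2^{i+1}}) ∏_{j=0}^{i−1} v(q^{−2^{j+1}})
  / ∏_{k=0}^{i} (1 − q^{1−2^{k+1}})`. -/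
noncomputable def Hterm (q ℓ i : ℕ) : ℝ :=
  (-1 : ℝ) ^ i * uPoly q ℓ ((q : ℝ) ^ (-(2 : ℤ) ^ (i + 1))) *
      (∏ j ∈ Finset.range i, vPoly q ℓ ((q : ℝ) ^ (-(2 : ℤ) ^ (j + 1)))) /
    ∏ k ∈ Finset.range (i + 1), (1 - (q : ℝ) ^ ((1 : ℤ) - 2 ^ (k + 1)))


theorem isBifix_iff {α : Type*} {V W : List α} :
    IsBifix V W ↔ V ≠ [] ∧ V <+: W ∧ V <:+ W ∧ V.length < W.length := by
  unfold IsBifix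
  constructor
  · rintro ⟨h, ⟨A, hA, rfl⟩, ⟨B, hB, hBV⟩⟩
    refine ⟨h, List.prefix_append _ _, ⟨B, hBV.symm⟩, ?_⟩
    have := List.length_pos_iff.2 hA
    simp; omega
  · rintro ⟨h, ⟨A, rfl⟩, ⟨B, hB⟩, hl⟩
    refine ⟨h, ⟨A, ?_, rfl⟩, ⟨B, ?_, hB.symm⟩⟩
    · rintro rfl; simp at hl
    · rintro rfl
      have := congrArg List.length hB
      simp at this hl; simp [this] at hl

theorem IsBifix.trans {α : Type*} {U V W : List α} (h : IsBifix U V) (h' : IsBifix V W) :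
    IsBifix U W := by
  rw [isBifix_iff] at *
  exact ⟨h.1, h.2.1.trans h'.2.1, h.2.2.1.trans h'.2.2.1, h.2.2.2.trans h'.2.2.2⟩

/-- Two words, both a prefix and a suffix of a common word: the shorter is a bifix of the longer. -/
theorem isBifix_of_length_lt {α : Type*} {U V W : List α} (hU : U ≠ []) (h1 : U <+: W)
    (h2 : U <:+ W) (h3 : V <+: W) (h4 : V <:+ W) (h : U.length < V.length) : IsBifix U V :=
  isBifix_iff.2 ⟨hU, List.prefix_of_prefix_length_le h1 h3 h.le,
    List.suffix_of_suffix_length_le h2 h4 h.le, h⟩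

theorem eq_append_middle {α : Type*} {U V : List α} (h1 : U <+: V) (h2 : U <:+ V)
    (h : 2 * U.length ≤ V.length) : ∃ C, V = U ++ C ++ U := by
  obtain ⟨X, rfl⟩ := h1
  have : U <:+ X := List.suffix_of_suffix_length_le h2 (List.suffix_append _ _) (by simp at h; omega)
  obtain ⟨C, rfl⟩ := this
  exact ⟨C, by simp⟩

theorem eq_append_drop {α : Type*} {U V : List α} (h1 : U <+: V) (h2 : U <:+ V)
    (hlt : U.length < V.length) (h : V.length < 2 * U.length) :
    ∃ Z, IsBifix Z U ∧ Z.length + V.length = 2 * U.length ∧ V = U ++ U.drop Z.length := by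
  obtain ⟨X, rfl⟩ := h1
  simp at h hlt
  have hX : X <:+ U := List.suffix_of_suffix_length_le (List.suffix_append _ _) h2 (by omega)
  obtain ⟨Z, hZ⟩ := hX
  have hl := congrArg List.length hZ
  simp at hl
  refine ⟨Z, isBifix_iff.2 ⟨?_, ⟨X, hZ⟩, ?_, by omega⟩, by simp; omega, ?_⟩
  · rintro rfl; simp at hl; omega
  · obtain ⟨Y, hY⟩ : Z ++ X <:+ U ++ X := hZ ▸ h2
    exact ⟨Y, by simpa [← List.append_assoc] using hY⟩
  · rw [List.append_right_inj, ← hZ, List.drop_left]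

/-- Words longer than `LL` which begin and end with `L`. -/
def framed {α : Type*} (L : List α) : Set (List α) :=
  {V | L <+: V ∧ L <:+ V ∧ 2 * L.length < V.length}

/-- Framed words without framed bifixes. -/
def minFramed {α : Type*} (L : List α) : Set (List α) :=
  {V | V ∈ framed L ∧ ∀ U, IsBifix U V → U ∉ framed L}

/-- Framed words which begin and end with `LL`. -/
def doubleFramed {α : Type*} (L : List α) : Set (List α) :=
  {V | V ∈ framed L ∧ L ++ L <+: V ∧ L ++ L <:+ V}

theorem framed_ne_nil {α : Type*} {L V : List α} (h : V ∈ framed L) : V ≠ [] := by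
  rintro rfl
  have := h.2.2
  simp at this

theorem framed_of_isBifix {α : Type*} {L U V : List α} (h : U ∈ framed L) (hb : IsBifix U V) :
    V ∈ framed L := by
  rw [isBifix_iff] at hb
  exact ⟨h.1.trans hb.2.1, h.2.1.trans hb.2.2.1, h.2.2.trans hb.2.2.2⟩

theorem doubleFramed_iff_of_isBifix {α : Type*} {L U V : List α} (h : U ∈ framed L)
    (hb : IsBifix U V) : V ∈ doubleFramed L ↔ U ∈ doubleFramed L := by
  have hV := framed_of_isBifix h hb
  rw [isBifix_iff] at hb
  have hl : (L ++ L).length ≤ U.length := by have := h.2.2; simp; omega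
  constructor
  · rintro ⟨-, h1, h2⟩
    exact ⟨h, List.prefix_of_prefix_length_le h1 hb.2.1 hl,
      List.suffix_of_suffix_length_le h2 hb.2.2.1 hl⟩
  · rintro ⟨-, h1, h2⟩
    exact ⟨hV, h1.trans hb.2.1, h2.trans hb.2.2.1⟩

/-- The bifixes of a word which begins and ends with a bifix-free word `L`. -/
theorem BifixFree.bifix_cases {α : Type*} {L U Z : List α} (hL : BifixFree L) (hL0 : L ≠ [])
    (h1 : L <+: U) (h2 : L <:+ U) (hZ : IsBifix Z U) : Z = L ∨ Z = L ++ L ∨ Z ∈ framed L := by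
  have hZ' := isBifix_iff.1 hZ
  rcases lt_trichotomy Z.length L.length with h | h | h
  · exact absurd (isBifix_of_length_lt hZ'.1 hZ'.2.1 hZ'.2.2.1 h1 h2 h) (hL _)
  · exact .inl ((List.prefix_of_prefix_length_le hZ'.2.1 h1 h.le).eq_of_length h)
  · have hb := isBifix_iff.1 (isBifix_of_length_lt hL0 h1 h2 hZ'.2.1 hZ'.2.2.1 h)
    rcases lt_trichotomy Z.length (2 * L.length) with h' | h' | h'
    · obtain ⟨Y, hY, -⟩ := eq_append_drop hb.2.1 hb.2.2.1 h h'
      exact absurd hY (hL _)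
    · obtain ⟨C, hC⟩ := eq_append_middle hb.2.1 hb.2.2.1 h'.ge
      have hl := congrArg List.length hC
      have : C = [] := List.length_eq_zero_iff.1 (by simp at hl; omega)
      subst this
      exact .inr (.inl (by simpa using hC))
    · exact .inr (.inr ⟨hb.2.1, hb.2.2.1, h'⟩)

theorem exists_shortest {α : Type*} {p : List α → Prop} (h : ∃ V, p V) :
    ∃ V, p V ∧ ∀ U, p U → V.length ≤ U.length := by
  obtain ⟨V, hV, hmin⟩ := (measure (List.length (α := α))).wf.has_min {V | p V} h
  exact ⟨V, hV, fun U hU => not_lt.1 (hmin U hU)⟩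

theorem exists_minFramed_bifix {α : Type*} {L V : List α} (hV : V ∈ framed L)
    (hm : V ∉ minFramed L) : ∃ U ∈ minFramed L, IsBifix U V := by
  have : ∃ U, IsBifix U V ∧ U ∈ framed L := by
    by_contra! h
    exact hm ⟨hV, h⟩
  obtain ⟨U, ⟨hU, hUL⟩, hmin⟩ := exists_shortest this
  refine ⟨U, ⟨hUL, fun X hX hXL => ?_⟩, hU⟩
  have := hmin X ⟨hX.trans hU, hXL⟩
  have := (isBifix_iff.1 hX).2.2.2
  omega

theorem minFramed_unique {α : Type*} {L U U' V : List α} (hU : U ∈ minFramed L)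
    (hU' : U' ∈ minFramed L) (hb : IsBifix U V) (hb' : IsBifix U' V) : U = U' := by
  have h := isBifix_iff.1 hb
  have h' := isBifix_iff.1 hb'
  rcases lt_trichotomy U.length U'.length with hl | hl | hl
  · exact absurd hU.1
      (hU'.2 _ (isBifix_of_length_lt h.1 h.2.1 h.2.2.1 h'.2.1 h'.2.2.1 hl))
  · exact (List.prefix_of_prefix_length_le h.2.1 h'.2.1 hl.le).eq_of_length hl
  · exact absurd hU'.1
      (hU.2 _ (isBifix_of_length_lt h'.1 h'.2.1 h'.2.2.1 h.2.1 h.2.2.1 hl))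

theorem bifixFree_unique {α : Type*} {L L' V : List α} (h0 : L ≠ []) (h0' : L' ≠ [])
    (hL : BifixFree L) (hL' : BifixFree L') (h1 : L <+: V) (h2 : L <:+ V)
    (h1' : L' <+: V) (h2' : L' <:+ V) : L = L' := by
  rcases lt_trichotomy L.length L'.length with hl | hl | hl
  · exact absurd (isBifix_of_length_lt h0 h1 h2 h1' h2' hl) (hL' _)
  · exact (List.prefix_of_prefix_length_le h1 h1' hl.le).eq_of_length hl
  · exact absurd (isBifix_of_length_lt h0' h1' h2' h1 h2 hl) (hL _)

/-- A word with a minimal framed bifix `U` consists of two copies of `U` that are either disjoint,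
or overlap in `L`, or overlap in `LL`. -/
theorem minFramed_bifix_cases {α : Type*} {L U V : List α} (hL : BifixFree L) (hL0 : L ≠ [])
    (hU : U ∈ minFramed L) (hb : IsBifix U V) :
    (∃ C, V = U ++ C ++ U) ∨ V = U ++ U.drop L.length ∨
      (U ∈ doubleFramed L ∧ V = U ++ U.drop (2 * L.length)) := by
  have h := isBifix_iff.1 hb
  rcases le_or_gt (2 * U.length) V.length with hl | hl
  · exact .inl (eq_append_middle h.2.1 h.2.2.1 hl)
  · obtain ⟨Z, hZ, hZl, hV⟩ := eq_append_drop h.2.1 h.2.2.1 h.2.2.2 hl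
    rcases hL.bifix_cases hL0 hU.1.1 hU.1.2.1 hZ with rfl | rfl | hZL
    · exact .inr (.inl hV)
    · refine .inr (.inr ⟨⟨hU.1, (isBifix_iff.1 hZ).2.1, (isBifix_iff.1 hZ).2.2.1⟩, ?_⟩)
      rw [hV]; simp [two_mul]
    · exact absurd hZL (hU.2 _ hZ)

theorem isBifix_append_middle {α : Type*} {U : List α} (C : List α) (h : U ≠ []) :
    IsBifix U (U ++ C ++ U) := by
  refine isBifix_iff.2 ⟨h, by simp, List.suffix_append _ _, ?_⟩
  have := List.length_pos_iff.2 h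
  simp; omega

theorem isBifix_append_drop {α : Type*} {U Z : List α} (h : IsBifix Z U) :
    IsBifix U (U ++ U.drop Z.length) := by
  obtain ⟨h0, ⟨X, rfl⟩, ⟨Y, hY⟩, hl⟩ := isBifix_iff.1 h
  refine isBifix_iff.2 ⟨by simp [h0], List.prefix_append _ _, ⟨Y, ?_⟩, ?_⟩
  · rw [List.drop_left, ← List.append_assoc, hY]
  · simp at hl ⊢; omega

theorem isBifix_of_mem_framed {α : Type*} {L U : List α} (hL0 : L ≠ []) (h : U ∈ framed L) :
    IsBifix L U := isBifix_iff.2 ⟨hL0, h.1, h.2.1, by have := h.2.2; omega⟩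

theorem isBifix_of_mem_doubleFramed {α : Type*} {L U : List α} (hL0 : L ≠ []) (h : U ∈ doubleFramed L) :
    IsBifix (L ++ L) U :=
  isBifix_iff.2 ⟨by simp [hL0], h.2.1, h.2.2, by have := h.1.2.2; simp; omega⟩

theorem framed_eq_image {α : Type*} (L : List α) :
    framed L = (fun B => L ++ B ++ L) '' {[]}ᶜ := by
  ext V
  constructor
  · rintro ⟨h1, h2, h3⟩
    obtain ⟨C, rfl⟩ := eq_append_middle h1 h2 h3.le
    refine ⟨C, ?_, rfl⟩
    rintro rfl
    simp at h3; omega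
  · rintro ⟨B, hB, rfl⟩
    have := List.length_pos_iff.2 hB
    exact ⟨by simp, List.suffix_append _ _, by simp; omega⟩

theorem doubleFramed_eq {α : Type*} {L : List α} (hL : BifixFree L) (hL0 : L ≠ []) :
    doubleFramed L = {L ++ L ++ L} ∪ (fun B => (L ++ L) ++ B ++ (L ++ L)) '' Set.univ := by
  have hpos := List.length_pos_iff.2 hL0
  ext V
  constructor
  · rintro ⟨⟨h1, h2, h3⟩, h4, h5⟩
    rcases le_or_gt (2 * (L ++ L).length) V.length with hl | hl
    · obtain ⟨C, rfl⟩ := eq_append_middle h4 h5 hl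
      exact .inr ⟨C, trivial, rfl⟩
    · obtain ⟨Z, hZ, hZl, hV⟩ := eq_append_drop h4 h5 (by simp; omega) hl
      have hZ' := (isBifix_iff.1 hZ).2.2.2
      rcases hL.bifix_cases hL0 (List.prefix_append L L) (List.suffix_append L L) hZ with
        rfl | rfl | hZL
      · left; simp [hV]
      · simp at hZ'
      · have := hZL.2.2
        simp at hZ'; omega
  · rintro (rfl | ⟨B, -, rfl⟩)
    · refine ⟨⟨by simp, List.suffix_append _ _, by simp; omega⟩, List.prefix_append _ _, ?_⟩
      exact ⟨L, by simp⟩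
    · exact ⟨⟨⟨L ++ B ++ (L ++ L), by simp⟩, ⟨L ++ L ++ B ++ L, by simp⟩, by simp; omega⟩,
        ⟨B ++ (L ++ L), by simp⟩, List.suffix_append _ _⟩

/-- `Z₃`-instances have a (unique) minimal framed bifix occupying less than half of the word. -/
theorem z3Instance_iff {α : Type*} {W : List α} :
    Z3Instance W ↔ ∃ L V, (L ≠ [] ∧ BifixFree L) ∧ V ∈ minFramed L ∧
      V <+: W ∧ V <:+ W ∧ 2 * V.length < W.length := by
  constructor
  · rintro ⟨A, B, C, hA, hB, hC, rfl⟩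
    have hAl := List.length_pos_iff.2 hA
    have hBl := List.length_pos_iff.2 hB
    have hCl := List.length_pos_iff.2 hC
    obtain ⟨L, ⟨hL0, hL1, hL2, hLl⟩, hmin⟩ := exists_shortest
      (p := fun X => X ≠ [] ∧ X <+: A ++ B ++ A ∧ X <:+ A ++ B ++ A ∧
        2 * X.length < (A ++ B ++ A).length)
      ⟨A, hA, by simp, List.suffix_append _ _, by simp; omega⟩
    have hLf : A ++ B ++ A ∈ framed L := ⟨hL1, hL2, hLl⟩
    have hL : BifixFree L := by
      intro X hX
      have hX' := isBifix_iff.1 hX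
      have := hmin X ⟨hX'.1, hX'.2.1.trans hL1, hX'.2.2.1.trans hL2, by omega⟩
      omega
    have h1 : A ++ B ++ A <+: A ++ B ++ A ++ C ++ A ++ B ++ A := ⟨C ++ A ++ B ++ A, by simp⟩
    have h2 : A ++ B ++ A <:+ A ++ B ++ A ++ C ++ A ++ B ++ A := ⟨A ++ B ++ A ++ C, by simp⟩
    by_cases hm : A ++ B ++ A ∈ minFramed L
    · exact ⟨L, _, ⟨hL0, hL⟩, hm, h1, h2, by simp; omega⟩
    · obtain ⟨U, hU, hUb⟩ := exists_minFramed_bifix hLf hm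
      have := isBifix_iff.1 hUb
      refine ⟨L, U, ⟨hL0, hL⟩, hU, this.2.1.trans h1, this.2.2.1.trans h2, ?_⟩
      have := this.2.2.2
      simp at this ⊢; omega
  · rintro ⟨L, V, ⟨hL0, -⟩, hV, h1, h2, hl⟩
    obtain ⟨C, rfl⟩ := eq_append_middle h1 h2 hl.le
    obtain ⟨B, hB, rfl⟩ := (framed_eq_image L) ▸ hV.1
    refine ⟨L, B, C, hL0, hB, ?_, by simp⟩
    rintro rfl
    simp at hl; omega

theorem exists_bifixFree {α : Type*} [Nontrivial α] (n : ℕ) :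
    ∃ L : List α, L.length = n + 1 ∧ BifixFree L := by
  obtain ⟨a, b, hab⟩ := exists_pair_ne α
  refine ⟨List.replicate n a ++ [b], by simp, fun V hV => ?_⟩
  obtain ⟨h0, h1, ⟨Y, hY⟩, hl⟩ := isBifix_iff.1 hV
  have hb : b ∈ V := by
    have := congrArg List.getLast? hY
    rw [List.getLast?_append_of_ne_nil _ h0] at this
    exact List.mem_of_getLast? (by simpa using this)
  have hp : V <+: List.replicate n a :=
    List.prefix_of_prefix_length_le h1 (List.prefix_append _ _) (by simp at hl ⊢; omega)
  exact hab (List.eq_of_mem_replicate (hp.subset hb)).symm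

theorem card_words (q n : ℕ) : Nat.card {V : List (Fin q) // V.length = n} = q ^ n := by
  have h : Nat.card (List.Vector (Fin q) n) = q ^ n := by
    rw [Nat.card_eq_fintype_card, card_vector, Fintype.card_fin]
  exact h

instance wordsFintype {q n : ℕ} : Fintype {V : List (Fin q) // V.length = n} :=
  inferInstanceAs (Fintype (List.Vector (Fin q) n))

theorem hasSum_words {q : ℕ} {x : ℝ} (h0 : 0 ≤ x) (h1 : q * x < 1) :
    HasSum (fun V : List (Fin q) => x ^ V.length) (1 - q * x)⁻¹ := by
  have hfib (n : ℕ) : HasSum (fun V : {V : List (Fin q) // V.length = n} => x ^ V.1.length)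
      ((q * x) ^ n) := by
    have h := hasSum_fintype (fun V : {V : List (Fin q) // V.length = n} => x ^ V.1.length)
    have hs : ∑ V : {V : List (Fin q) // V.length = n}, x ^ V.1.length = (q * x) ^ n := by
      rw [Finset.sum_congr rfl (fun V _ => by rw [V.2]), Finset.sum_const, Finset.card_univ,
        ← Nat.card_eq_fintype_card, card_words, nsmul_eq_mul, mul_pow]
      push_cast; rfl
    rwa [hs] at h
  have hgeo := hasSum_geometric_of_lt_one (by positivity) h1
  rw [← (Equiv.sigmaFiberEquiv (List.length (α := Fin q))).hasSum_iff]
  refine HasSum.sigma_of_hasSum hgeo hfib ?_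
  refine (summable_sigma_of_nonneg fun _ => pow_nonneg h0 _).2
    ⟨fun n => (hfib n).summable, hgeo.summable.congr fun n => (hfib n).tsum_eq.symm⟩

/-- The generating function of a set of words. -/
noncomputable def wordSum {q : ℕ} (x : ℝ) (A : Set (List (Fin q))) : ℝ :=
  ∑' V : A, x ^ V.1.length

theorem summable_words {q : ℕ} {x : ℝ} (h0 : 0 ≤ x) (h1 : q * x < 1) (A : Set (List (Fin q))) :
    Summable (fun V : A => x ^ V.1.length) :=
  (hasSum_words h0 h1).summable.subtype A

theorem wordSum_nonneg {q : ℕ} {x : ℝ} (h0 : 0 ≤ x) (A : Set (List (Fin q))) :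
    0 ≤ wordSum x A := tsum_nonneg fun _ => by positivity

theorem wordSum_mono {q : ℕ} {x : ℝ} (h0 : 0 ≤ x) (h1 : q * x < 1) {A B : Set (List (Fin q))}
    (h : A ⊆ B) : wordSum x A ≤ wordSum x B :=
  (summable_words h0 h1 A).tsum_le_tsum_of_inj (Set.inclusion h) (Set.inclusion_injective h)
    (fun _ _ => by positivity) (fun _ => le_rfl) (summable_words h0 h1 B)

theorem wordSum_univ {q : ℕ} {x : ℝ} (h0 : 0 ≤ x) (h1 : q * x < 1) :
    wordSum x (Set.univ : Set (List (Fin q))) = (1 - q * x)⁻¹ := by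
  rw [wordSum, tsum_univ (fun V : List (Fin q) => x ^ V.length)]
  exact (hasSum_words h0 h1).tsum_eq

theorem wordSum_singleton {q : ℕ} (x : ℝ) (V : List (Fin q)) :
    wordSum x {V} = x ^ V.length := by
  rw [wordSum, tsum_singleton V (fun V : List (Fin q) => x ^ V.length)]

theorem wordSum_union {q : ℕ} {x : ℝ} (h0 : 0 ≤ x) (h1 : q * x < 1) {A B : Set (List (Fin q))}
    (h : Disjoint A B) : wordSum x (A ∪ B) = wordSum x A + wordSum x B :=
  Summable.tsum_union_disjoint (f := fun V : List (Fin q) => x ^ V.length) h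
    (summable_words h0 h1 A) (summable_words h0 h1 B)

theorem wordSum_compl_nil {q : ℕ} {x : ℝ} (h0 : 0 ≤ x) (h1 : q * x < 1) :
    wordSum x ({[]}ᶜ : Set (List (Fin q))) = (1 - q * x)⁻¹ - 1 := by
  have h := wordSum_union h0 h1 (disjoint_compl_right (a := ({[]} : Set (List (Fin q)))))
  rw [Set.union_compl_self, wordSum_univ h0 h1, wordSum_singleton] at h
  rw [h]; simp

theorem wordSum_image {q : ℕ} {x y z : ℝ} {A : Set (List (Fin q))}
    {φ : List (Fin q) → List (Fin q)} (hφ : Set.InjOn φ A)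
    (h : ∀ V ∈ A, x ^ (φ V).length = z * y ^ V.length) : wordSum x (φ '' A) = z * wordSum y A := by
  rw [wordSum, tsum_image (fun V : List (Fin q) => x ^ V.length) hφ, wordSum, ← tsum_mul_left]
  exact tsum_congr fun V => h V.1 V.2

theorem wordSum_frame {q : ℕ} {x : ℝ} (L : List (Fin q)) (A : Set (List (Fin q))) :
    wordSum x ((fun B => L ++ B ++ L) '' A) = x ^ (2 * L.length) * wordSum x A := by
  refine wordSum_image (fun B _ C _ h => by simpa using h) fun V _ => ?_
  simp; ring

/-- Words consisting of two disjoint copies of a member of `A`. -/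
def separatedDoubles {α : Type*} (A : Set (List α)) : Set (List α) :=
  (fun p : List α × List α => p.1 ++ p.2 ++ p.1) '' {p | p.1 ∈ A}

/-- Words consisting of two copies of a member of `A` overlapping in `k` letters. -/
def overlappingDoubles {α : Type*} (k : ℕ) (A : Set (List α)) : Set (List α) :=
  (fun U => U ++ U.drop k) '' A

theorem wordSum_separatedDoubles {q : ℕ} {x : ℝ} (h0 : 0 ≤ x) (h1 : q * x < 1) (hx : x ≤ 1)
    {A : Set (List (Fin q))}
    (hA : ∀ U ∈ A, ∀ U' ∈ A, ∀ V, IsBifix U V → IsBifix U' V → U = U') (hne : [] ∉ A) :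
    wordSum x (separatedDoubles A) = wordSum (x ^ 2) A * (1 - q * x)⁻¹ := by
  have hx2 : (q : ℝ) * x ^ 2 < 1 := by
    refine lt_of_le_of_lt ?_ h1
    gcongr
    nlinarith
  rw [separatedDoubles, wordSum, tsum_image (fun V : List (Fin q) => x ^ V.length)]
  · let e : A × List (Fin q) ≃ {p : List (Fin q) × List (Fin q) | p.1 ∈ A} :=
      { toFun := fun p => ⟨(p.1.1, p.2), p.1.2⟩
        invFun := fun p => (⟨p.1.1, p.2⟩, p.1.2)
        left_inv := fun _ => rfl
        right_inv := fun _ => rfl }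
    rw [← e.tsum_eq, wordSum, ← (hasSum_words h0 h1).tsum_eq,
      tsum_mul_tsum_of_summable_norm]
    · refine tsum_congr fun p => ?_
      simp only [e, Equiv.coe_fn_mk, List.length_append]
      ring
    · exact (summable_words (by positivity) hx2 A).norm
    · exact (hasSum_words h0 h1).summable.norm
  · rintro ⟨U, C⟩ hU ⟨U', C'⟩ hU' h
    simp only at h
    have hn : U ≠ [] := fun h => hne (h ▸ hU)
    have hn' : U' ≠ [] := fun h => hne (h ▸ hU')
    obtain rfl := hA U hU U' hU' _ (isBifix_append_middle C hn)
      (h ▸ isBifix_append_middle C' hn')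
    simpa using h

theorem wordSum_overlappingDoubles {q : ℕ} {x : ℝ} (hx : x ≠ 0) {k : ℕ} {A : Set (List (Fin q))}
    (hA : ∀ U ∈ A, ∀ U' ∈ A, ∀ V, IsBifix U V → IsBifix U' V → U = U')
    (hk : ∀ U ∈ A, ∃ Z, Z.length = k ∧ IsBifix Z U) :
    wordSum x (overlappingDoubles k A) = (x ^ k)⁻¹ * wordSum (x ^ 2) A := by
  refine wordSum_image (fun U hU U' hU' h => ?_) fun U hU => ?_
  · obtain ⟨Z, rfl, hZ⟩ := hk U hU
    obtain ⟨Z', hl, hZ'⟩ := hk U' hU'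
    refine hA U hU U' hU' _ (isBifix_append_drop hZ) ?_
    rw [show U ++ U.drop Z.length = U' ++ U'.drop Z.length from h, ← hl]
    exact isBifix_append_drop hZ'
  · obtain ⟨Z, rfl, hZ⟩ := hk U hU
    have := (isBifix_iff.1 hZ).2.2.2
    rw [eq_inv_mul_iff_mul_eq₀ (by positivity), ← pow_add, ← pow_mul]
    congr 1
    simp; omega

theorem wordSum_framed {q : ℕ} {x : ℝ} (h0 : 0 ≤ x) (h1 : q * x < 1) (L : List (Fin q)) :
    wordSum x (framed L) = x ^ (2 * L.length) * ((1 - q * x)⁻¹ - 1) := by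
  rw [framed_eq_image, wordSum_frame, wordSum_compl_nil h0 h1]

theorem wordSum_doubleFramed {q : ℕ} {x : ℝ} (h0 : 0 ≤ x) (h1 : q * x < 1) {L : List (Fin q)}
    (hL : BifixFree L) (hL0 : L ≠ []) :
    wordSum x (doubleFramed L) =
      x ^ (3 * L.length) + x ^ (4 * L.length) * (1 - q * x)⁻¹ := by
  rw [doubleFramed_eq hL hL0, wordSum_union h0 h1, wordSum_singleton, wordSum_frame,
    wordSum_univ h0 h1]
  · congr 2
    · simp only [List.length_append]; ring
    · rw [List.length_append, ← two_mul, ← mul_assoc]; norm_num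
  · rw [Set.disjoint_singleton_left]
    rintro ⟨B, -, hB⟩
    have hpos := List.length_pos_iff.2 hL0
    have hl := congrArg List.length hB
    simp at hl; omega

/-- Decomposition of a set of framed words according to the minimal framed bifix. -/
theorem decompose_framed {α : Type*} {L : List α} (hL : BifixFree L) (hL0 : L ≠ [])
    {R : Set (List α)} (hR : R ⊆ framed L)
    (hRb : ∀ U V, U ∈ framed L → IsBifix U V → (V ∈ R ↔ U ∈ R)) :
    R = (minFramed L ∩ R) ∪ (separatedDoubles (minFramed L ∩ R) ∪
      (overlappingDoubles L.length (minFramed L ∩ R) ∪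
        overlappingDoubles (2 * L.length) (minFramed L ∩ R ∩ doubleFramed L))) := by
  ext V
  constructor
  · intro hV
    by_cases hm : V ∈ minFramed L
    · exact .inl ⟨hm, hV⟩
    · obtain ⟨U, hU, hb⟩ := exists_minFramed_bifix (hR hV) hm
      have hUR : U ∈ R := (hRb U V hU.1 hb).1 hV
      rcases minFramed_bifix_cases hL hL0 hU hb with ⟨C, rfl⟩ | rfl | ⟨hD, rfl⟩
      · exact .inr (.inl ⟨(U, C), ⟨hU, hUR⟩, rfl⟩)
      · exact .inr (.inr (.inl ⟨U, ⟨hU, hUR⟩, rfl⟩))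
      · exact .inr (.inr (.inr ⟨U, ⟨⟨hU, hUR⟩, hD⟩, rfl⟩))
  · rintro (h | ⟨⟨U, C⟩, ⟨hU, hUR⟩, rfl⟩ | ⟨U, ⟨hU, hUR⟩, rfl⟩ | ⟨U, ⟨⟨hU, hUR⟩, hD⟩, rfl⟩)
    · exact h.2
    · exact (hRb U _ hU.1 (isBifix_append_middle C (framed_ne_nil hU.1))).2 hUR
    · exact (hRb U _ hU.1 (isBifix_append_drop (isBifix_of_mem_framed hL0 hU.1))).2 hUR
    · refine (hRb U _ hU.1 ?_).2 hUR
      simpa [two_mul] using isBifix_append_drop (isBifix_of_mem_doubleFramed hL0 hD)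

theorem wordSum_decompose {q : ℕ} {x : ℝ} (h0 : 0 < x) (h1 : q * x < 1) (hx : x ≤ 1)
    {L : List (Fin q)} (hL : BifixFree L) (hL0 : L ≠ [])
    {R : Set (List (Fin q))} (hR : R ⊆ framed L)
    (hRb : ∀ U V, U ∈ framed L → IsBifix U V → (V ∈ R ↔ U ∈ R)) :
    wordSum x R = wordSum x (minFramed L ∩ R) +
      (wordSum (x ^ 2) (minFramed L ∩ R) * (1 - q * x)⁻¹ +
        ((x ^ L.length)⁻¹ * wordSum (x ^ 2) (minFramed L ∩ R) +
          (x ^ (2 * L.length))⁻¹ * wordSum (x ^ 2) (minFramed L ∩ R ∩ doubleFramed L))) := by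
  have hpos := List.length_pos_iff.2 hL0
  have hun : ∀ U ∈ minFramed L ∩ R, ∀ U' ∈ minFramed L ∩ R, ∀ V, IsBifix U V → IsBifix U' V →
      U = U' := fun U hU U' hU' V h h' => minFramed_unique hU.1 hU'.1 h h'
  have hb1 : ∀ U ∈ minFramed L, ∀ C, IsBifix U (U ++ C ++ U) := fun U hU C =>
    isBifix_append_middle C (framed_ne_nil hU.1)
  have hb2 : ∀ U ∈ minFramed L, IsBifix U (U ++ U.drop L.length) := fun U hU =>
    isBifix_append_drop (isBifix_of_mem_framed hL0 hU.1)
  have hb3 : ∀ U ∈ doubleFramed L, IsBifix U (U ++ U.drop (2 * L.length)) := fun U hU => by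
    simpa [two_mul] using isBifix_append_drop (isBifix_of_mem_doubleFramed hL0 hU)
  conv_lhs => rw [decompose_framed hL hL0 hR hRb]
  rw [wordSum_union h0.le h1, wordSum_union h0.le h1, wordSum_union h0.le h1,
    wordSum_separatedDoubles h0.le h1 hx hun (fun h => framed_ne_nil h.1.1 rfl),
    wordSum_overlappingDoubles h0.ne' hun
      (fun U hU => ⟨L, rfl, isBifix_of_mem_framed hL0 hU.1.1⟩),
    wordSum_overlappingDoubles h0.ne' (fun U hU U' hU' => hun U hU.1 U' hU'.1)
      (fun U hU => ⟨L ++ L, by simp [two_mul], isBifix_of_mem_doubleFramed hL0 hU.2⟩)]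
  · rw [Set.disjoint_left]
    rintro _ ⟨U, ⟨hU, hUR⟩, rfl⟩ ⟨U', ⟨⟨hU', hUR'⟩, hD⟩, h⟩
    simp only at h
    obtain rfl := minFramed_unique hU hU' (hb2 U hU) (h ▸ hb3 U' hD)
    have := congrArg List.length h
    have := hU.1.2.2
    simp at *; omega
  · rw [Set.disjoint_left]
    rintro _ ⟨⟨U, C⟩, ⟨hU, hUR⟩, rfl⟩ (⟨U', ⟨hU', hUR'⟩, h⟩ | ⟨U', ⟨⟨hU', hUR'⟩, hD⟩, h⟩)
    · simp only at h hU
      obtain rfl := minFramed_unique hU hU' (hb1 U hU C) (h ▸ hb2 U' hU')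
      have := congrArg List.length h
      have := hU.1.2.2
      simp at *; omega
    · simp only at h hU
      obtain rfl := minFramed_unique hU hU' (hb1 U hU C) (h ▸ hb3 U' hD)
      have := congrArg List.length h
      have := hU.1.2.2
      simp at *; omega
  · rw [Set.disjoint_left]
    rintro V ⟨hV, -⟩
      (⟨⟨U, C⟩, ⟨hU, -⟩, rfl⟩ | ⟨U, ⟨hU, -⟩, rfl⟩ | ⟨U, ⟨⟨hU, -⟩, hD⟩, rfl⟩)
    · exact hV.2 U (hb1 U hU C) hU.1
    · exact hV.2 U (hb2 U hU) hU.1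
    · exact hV.2 U (hb3 U hD) hU.1

theorem wordSum_minFramed {q : ℕ} {x : ℝ} (h0 : 0 < x) (h1 : q * x < 1) (hx : x ≤ 1)
    {L : List (Fin q)} (hL : BifixFree L) (hL0 : L ≠ []) :
    x ^ (2 * L.length) * ((1 - q * x)⁻¹ - 1) = wordSum x (minFramed L) +
      (wordSum (x ^ 2) (minFramed L) * (1 - q * x)⁻¹ +
        ((x ^ L.length)⁻¹ * wordSum (x ^ 2) (minFramed L) +
          (x ^ (2 * L.length))⁻¹ * wordSum (x ^ 2) (minFramed L ∩ doubleFramed L))) := by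
  have hM : minFramed L ∩ framed L = minFramed L := Set.inter_eq_left.2 fun _ h => h.1
  have h := wordSum_decompose h0 h1 hx hL hL0 subset_rfl
    fun U V hU hb => iff_of_true (framed_of_isBifix hU hb) hU
  rwa [wordSum_framed h0.le h1, hM] at h

theorem wordSum_minFramed_inter {q : ℕ} {x : ℝ} (h0 : 0 < x) (h1 : q * x < 1) (hx : x ≤ 1)
    {L : List (Fin q)} (hL : BifixFree L) (hL0 : L ≠ []) :
    x ^ (3 * L.length) + x ^ (4 * L.length) * (1 - q * x)⁻¹ =
      wordSum x (minFramed L ∩ doubleFramed L) +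
      (wordSum (x ^ 2) (minFramed L ∩ doubleFramed L) * (1 - q * x)⁻¹ +
        ((x ^ L.length)⁻¹ * wordSum (x ^ 2) (minFramed L ∩ doubleFramed L) +
          (x ^ (2 * L.length))⁻¹ * wordSum (x ^ 2) (minFramed L ∩ doubleFramed L))) := by
  have h := wordSum_decompose h0 h1 hx hL hL0 (R := doubleFramed L) (fun _ h => h.1)
    fun U V hU hb => doubleFramed_iff_of_isBifix hU hb
  rwa [wordSum_doubleFramed h0.le h1 hL hL0, Set.inter_assoc, Set.inter_self] at h

theorem zpow_neg_two_pow {q : ℝ} (i : ℕ) : q ^ (-(2 : ℤ) ^ (i + 1)) = ((q ^ 2)⁻¹) ^ 2 ^ i := by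
  rw [zpow_neg, inv_pow, ← pow_mul, ← pow_succ']
  norm_cast

theorem zpow_one_sub_two_pow {q : ℝ} (hq : q ≠ 0) (k : ℕ) :
    q ^ ((1 : ℤ) - 2 ^ (k + 1)) = q * ((q ^ 2)⁻¹) ^ 2 ^ k := by
  rw [← zpow_neg_two_pow, ← zpow_one_add₀ hq, sub_eq_add_neg]

/-- Iterating the functional equation `(1 - qx) f(x) = ρ(x) - σ(x) f(x²)` from `x = q⁻²`. -/
theorem hasSum_of_functional_equation {q : ℕ} (hq : 2 ≤ q) {f ρ σ : ℝ → ℝ} {d : ℕ} {C c : ℝ}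
    (hC : 0 ≤ C) (hc : 0 < c)
    (hf : ∀ x : ℝ, 0 < x → q ^ 2 * x ≤ 1 → f x * (1 - q * x) = ρ x - σ x * f (x ^ 2))
    (hfb : ∀ x : ℝ, 0 < x → q ^ 2 * x ≤ 1 → |f x| ≤ C * x ^ (d + 1))
    (hσ : ∀ x : ℝ, 0 < x → q ^ 2 * x ≤ 1 → |σ x| * x ^ d ≤ c) :
    HasSum (fun i : ℕ => (-1 : ℝ) ^ i * ρ ((q : ℝ) ^ (-(2 : ℤ) ^ (i + 1))) *
      (∏ j ∈ Finset.range i, σ ((q : ℝ) ^ (-(2 : ℤ) ^ (j + 1)))) /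
        ∏ k ∈ Finset.range (i + 1), (1 - (q : ℝ) ^ ((1 : ℤ) - 2 ^ (k + 1))))
      (f ((q : ℝ) ^ 2)⁻¹) := by
  have hq' : (2 : ℝ) ≤ q := by exact_mod_cast hq
  have hq0 : (q : ℝ) ≠ 0 := by positivity
  simp only [zpow_neg_two_pow, zpow_one_sub_two_pow hq0]
  set X : ℕ → ℝ := fun i => (((q : ℝ) ^ 2)⁻¹) ^ 2 ^ i with hX
  have hX0 (i) : 0 < X i := by positivity
  have hXs (i) : X (i + 1) = X i ^ 2 := by simp only [hX]; rw [← pow_mul, ← pow_succ]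
  have hinv : ((q : ℝ) ^ 2)⁻¹ < 1 := inv_lt_one_of_one_lt₀ (by nlinarith)
  have hX1 (i) : (q : ℝ) ^ 2 * X i ≤ 1 := by
    have : X i ≤ ((q : ℝ) ^ 2)⁻¹ :=
      pow_le_of_le_one (by positivity) hinv.le (by positivity)
    calc (q : ℝ) ^ 2 * X i ≤ (q : ℝ) ^ 2 * ((q : ℝ) ^ 2)⁻¹ := by gcongr
      _ = 1 := mul_inv_cancel₀ (by positivity)
  have hden (i) : 1 / 2 ≤ 1 - q * X i := by
    have h1 := hX1 i
    have h2 := hX0 i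
    have : (2 : ℝ) * (q * X i) ≤ q * (q * X i) := by gcongr
    nlinarith
  have hden0 (i) : 1 - q * X i ≠ 0 := ne_of_gt (by linarith [hden i])
  set P : ℕ → ℝ := fun i =>
    (∏ j ∈ Finset.range i, σ (X j)) / ∏ k ∈ Finset.range i, (1 - q * X k) with hP
  have hPs (i) : P (i + 1) = P i * (σ (X i) / (1 - q * X i)) := by
    simp only [hP, Finset.prod_range_succ]
    rw [mul_div_mul_comm]
  have hPb (i) : |P i| * X i ^ d ≤ (2 * c) ^ i := by
    induction i with
    | zero => simpa [hP] using pow_le_one₀ (hX0 0).le (by simpa [hX] using hinv.le)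
    | succ i ih =>
      have h2 : |σ (X i) / (1 - q * X i)| * X i ^ d ≤ 2 * c := by
        rw [abs_div, abs_of_pos (by linarith [hden i] : 0 < 1 - q * X i), div_mul_eq_mul_div,
          div_le_iff₀ (by linarith [hden i])]
        nlinarith [hσ _ (hX0 i) (hX1 i), hden i]
      calc |P (i + 1)| * X (i + 1) ^ d
          = (|P i| * X i ^ d) * (|σ (X i) / (1 - q * X i)| * X i ^ d) := by
            rw [hPs, hXs, abs_mul]; ring
        _ ≤ (2 * c) ^ i * (2 * c) := by gcongr
        _ = (2 * c) ^ (i + 1) := (pow_succ _ _).symm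
  set R : ℕ → ℝ := fun i => (-1) ^ i * f (X i) * P i with hR
  have hbound : Summable fun i => C * ((2 * c) ^ i * X i) := by
    refine Summable.mul_left _ (summable_of_ratio_test_tendsto_lt_one (l := 0) one_pos ?_ ?_)
    · exact .of_forall fun i => by have := hX0 i; positivity
    · have hlim : Filter.Tendsto X Filter.atTop (nhds 0) :=
        (tendsto_pow_atTop_nhds_zero_of_lt_one (by positivity) hinv).comp
          (tendsto_pow_atTop_atTop_of_one_lt one_lt_two)
      have h := hlim.const_mul (2 * c)
      rw [mul_zero] at h
      refine h.congr fun i => ?_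
      have := hX0 i
      rw [hXs, Real.norm_of_nonneg (by positivity), Real.norm_of_nonneg (by positivity), pow_succ]
      field_simp
  have hRs : Summable R := by
    refine Summable.of_norm_bounded hbound fun i => ?_
    have h1 := hfb _ (hX0 i) (hX1 i)
    calc ‖R i‖ = |f (X i)| * |P i| := by simp [hR]
      _ ≤ C * X i ^ (d + 1) * |P i| := by gcongr
      _ = C * ((|P i| * X i ^ d) * X i) := by ring
      _ ≤ C * ((2 * c) ^ i * X i) := by
        have := hX0 i
        gcongr
        exact hPb i
  have hsum := hRs.hasSum.sub ((summable_nat_add_iff 1).2 hRs).hasSum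
  rw [hRs.tsum_eq_zero_add, add_sub_cancel_right,
    show R 0 = f ((q : ℝ) ^ 2)⁻¹ by simp [hR, hP, hX]] at hsum
  refine (congrArg (HasSum · _ _) (funext fun i => ?_)).mpr hsum
  have h := hf _ (hX0 i) (hX1 i)
  have hprod : ∏ k ∈ Finset.range i, (1 - q * X k) ≠ 0 :=
    Finset.prod_ne_zero_iff.2 fun k _ => hden0 k
  have hi := hden0 i
  change (-1) ^ i * ρ (X i) * (∏ j ∈ Finset.range i, σ (X j)) /
    ∏ k ∈ Finset.range (i + 1), (1 - q * X k) = R i - R (i + 1)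
  simp only [hR, hPs, hXs, pow_succ (-1 : ℝ), Finset.prod_range_succ]
  simp only [hP]
  rw [show ρ (X i) = f (X i) * (1 - q * X i) + σ (X i) * f (X i ^ 2) by linarith]
  field_simp
  ring

theorem rPoly_eq {q ℓ : ℕ} {x : ℝ} (hx : 0 < x) :
    rPoly q ℓ x = q * ((x ^ ℓ) ^ 2 * x) - (x ^ ℓ) ^ 4 + (x ^ ℓ) ^ 5 - q * ((x ^ ℓ) ^ 5 * x) +
      (x ^ ℓ) ^ 6 := by
  simp only [rPoly, zpow_add₀ hx.ne', zpow_one]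
  simp only [mul_comm _ (ℓ : ℤ), zpow_mul, zpow_natCast]
  norm_cast

theorem uPoly_eq {q ℓ : ℕ} {x : ℝ} (hx : 0 < x) :
    uPoly q ℓ x = q * ((x ^ ℓ) ^ 4 * x) - (x ^ ℓ) ^ 5 + q * ((x ^ ℓ) ^ 5 * x) -
      (x ^ ℓ) ^ 6 := by
  simp only [uPoly, zpow_add₀ hx.ne', zpow_one]
  simp only [mul_comm _ (ℓ : ℤ), zpow_mul, zpow_natCast]
  norm_cast

theorem sPoly_eq {q ℓ : ℕ} {x : ℝ} (hx : 0 < x) :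
    sPoly q ℓ x = 1 + (1 - q * x) * (x ^ ℓ)⁻¹ := by
  simp only [sPoly, zpow_sub₀ hx.ne', zpow_neg, zpow_one, zpow_natCast]
  ring

theorem vPoly_eq {q ℓ : ℕ} {x : ℝ} (hx : 0 < x) :
    vPoly q ℓ x = 1 + (1 - q * x) * ((x ^ ℓ)⁻¹ + ((x ^ ℓ) ^ 2)⁻¹) := by
  simp only [vPoly, zpow_sub₀ hx.ne', zpow_neg, zpow_one, zpow_natCast]
  rw [mul_comm 2 (ℓ : ℤ), zpow_mul, zpow_natCast]
  norm_cast
  ring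

theorem hasSum_Gterm_add_Hterm {q : ℕ} (hq : 2 ≤ q) {L : List (Fin q)} (hL : BifixFree L)
    (hL0 : L ≠ []) :
    HasSum (fun i => Gterm q L.length i + Hterm q L.length i)
      (wordSum ((q : ℝ) ^ 2)⁻¹ (minFramed L)) := by
  have hpos := List.length_pos_iff.2 hL0
  set ℓ := L.length with hℓ
  have hq' : (2 : ℝ) ≤ q := by exact_mod_cast hq
  set g : ℝ → ℝ := fun x => wordSum x (minFramed L) with hg
  set h : ℝ → ℝ := fun x => wordSum x (minFramed L ∩ doubleFramed L) with hh
  have dom {x : ℝ} (hx : 0 < x) (hqx : q ^ 2 * x ≤ 1) : x ≤ 1 ∧ 1 / 2 ≤ 1 - q * x := by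
    have : (2 : ℝ) * (q * x) ≤ q * (q * x) := by gcongr
    have : 2 * x ≤ q * x := by gcongr
    constructor <;> nlinarith
  have dom2 {x : ℝ} (hx : 0 < x) (hqx : q ^ 2 * x ≤ 1) : q ^ 2 * x ^ 2 ≤ 1 := by
    have := (dom hx hqx).1
    refine le_trans ?_ hqx
    gcongr
    nlinarith
  have hinv {x : ℝ} (hx : 0 < x) (hqx : q ^ 2 * x ≤ 1) : (1 - q * x)⁻¹ ≤ 2 :=
    inv_le_of_inv_le₀ (by norm_num) (by have := (dom hx hqx).2; linarith)
  have gb {x : ℝ} (hx : 0 < x) (hqx : q ^ 2 * x ≤ 1) : 0 ≤ g x ∧ g x ≤ 2 * q * (x ^ (2 * ℓ) * x) := by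
    refine ⟨wordSum_nonneg hx.le _, ?_⟩
    have hd := (dom hx hqx).2
    have h1 : q * x < 1 := by linarith
    refine (wordSum_mono hx.le h1 (fun _ h => h.1 : minFramed L ⊆ framed L)).trans ?_
    rw [wordSum_framed hx.le h1]
    have : (1 - q * x)⁻¹ - 1 = q * x * (1 - q * x)⁻¹ := by
      have : 1 - q * x ≠ 0 := by linarith
      field_simp; ring
    calc x ^ (2 * ℓ) * ((1 - q * x)⁻¹ - 1) = x ^ (2 * ℓ) * (q * x * (1 - q * x)⁻¹) := by rw [this]
      _ ≤ x ^ (2 * ℓ) * (q * x * 2) := by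
        have := hinv hx hqx
        gcongr
      _ = _ := by ring
  have hb {x : ℝ} (hx : 0 < x) (hqx : q ^ 2 * x ≤ 1) : 0 ≤ h x ∧ h x ≤ 3 * x ^ (3 * ℓ) := by
    refine ⟨wordSum_nonneg hx.le _, ?_⟩
    have hd := dom hx hqx
    have h1 : q * x < 1 := by linarith
    refine (wordSum_mono hx.le h1 Set.inter_subset_right).trans ?_
    rw [wordSum_doubleFramed hx.le h1 hL hL0]
    have : x ^ (4 * ℓ) * (1 - q * x)⁻¹ ≤ x ^ (3 * ℓ) * 2 := by
      have := hinv hx hqx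
      gcongr ?_ * ?_
      exact pow_le_pow_of_le_one hx.le hd.1 (by omega)
    linarith
  have geq {x : ℝ} (hx : 0 < x) (hqx : q ^ 2 * x ≤ 1) := wordSum_minFramed hx
    (by have := (dom hx hqx).2; linarith) (dom hx hqx).1 hL hL0
  have heq {x : ℝ} (hx : 0 < x) (hqx : q ^ 2 * x ≤ 1) := wordSum_minFramed_inter hx
    (by have := (dom hx hqx).2; linarith) (dom hx hqx).1 hL hL0
  -- remove the contribution of `LLL`
  set h' : ℝ → ℝ := fun x => h x - x ^ (3 * ℓ) with hh'
  have hb' {x : ℝ} (hx : 0 < x) (hqx : q ^ 2 * x ≤ 1) : |h' x| ≤ 14 * x ^ (4 * ℓ) := by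
    have hd := dom hx hqx
    have hi := hinv hx hqx
    have hi0 : 0 ≤ (1 - q * x)⁻¹ := inv_nonneg.2 (by linarith)
    obtain ⟨h0, h3⟩ := hb (pow_pos hx 2) (dom2 hx hqx)
    have hy : 0 < x ^ ℓ := by positivity
    have hy1 : x ^ ℓ ≤ 1 := pow_le_one₀ hx.le hd.1
    have e := heq hx hqx
    simp only [pow_mul', ← hℓ] at e
    have e' : h' x = (x ^ ℓ) ^ 4 * (1 - q * x)⁻¹ - h (x ^ 2) *
        ((1 - q * x)⁻¹ + (x ^ ℓ)⁻¹ + ((x ^ ℓ) ^ 2)⁻¹) := by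
      simp only [hh', hh, pow_mul']
      linear_combination -e
    rw [pow_mul', pow_right_comm x 2 ℓ] at h3
    rw [e', pow_mul']
    generalize x ^ ℓ = y at *
    generalize (1 - q * x)⁻¹ = D at *
    have hs : h (x ^ 2) * (D + y⁻¹ + (y ^ 2)⁻¹) ≤ 12 * y ^ 4 := by
      calc h (x ^ 2) * (D + y⁻¹ + (y ^ 2)⁻¹)
          ≤ 3 * (y ^ 3) ^ 2 * (2 * (y ^ 2)⁻¹ + (y ^ 2)⁻¹ + (y ^ 2)⁻¹) := by
            have h1 : 1 ≤ (y ^ 2)⁻¹ := (one_le_inv₀ (by positivity)).2 (by nlinarith)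
            gcongr
            · linarith
            · linarith
            · nlinarith
        _ = 12 * y ^ 4 := by field_simp; ring
    have hs0 : 0 ≤ h (x ^ 2) * (D + y⁻¹ + (y ^ 2)⁻¹) := by positivity
    have h4 : 0 ≤ y ^ 4 := by positivity
    have h5 : 0 ≤ y ^ 4 * D := by positivity
    have h6 : y ^ 4 * D ≤ y ^ 4 * 2 := by gcongr
    rw [abs_le]
    constructor <;> linarith
  have hH := hasSum_of_functional_equation hq (f := h') (ρ := uPoly q ℓ) (σ := vPoly q ℓ)
    (d := 2 * ℓ) (C := 14) (c := 3) (by norm_num) (by norm_num)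
    (fun x hx hqx => by
      have hd := dom hx hqx
      have hne : 1 - q * x ≠ 0 := by linarith
      have e := heq hx hqx
      rw [uPoly_eq hx, vPoly_eq hx]
      simp only [pow_mul', ← hℓ] at e
      simp only [hh', hh, pow_mul', pow_right_comm x 2]
      have hy : x ^ ℓ ≠ 0 := by positivity
      generalize x ^ ℓ = y at *
      have hY := mul_inv_cancel₀ hy
      have hD := mul_inv_cancel₀ hne
      simp only [← inv_pow] at e ⊢
      generalize y⁻¹ = Y at *
      generalize (1 - q * x)⁻¹ = D at *
      linear_combination (-(1 - q * x)) * e + (y ^ 4 - wordSum (x ^ 2) (minFramed L ∩ doubleFramed L)) * hD -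
        (1 - q * x) * (y ^ 5 + y ^ 4 * (y * Y + 1)) * hY)
    (fun x hx hqx => (hb' hx hqx).trans (by
      gcongr 14 * ?_
      exact pow_le_pow_of_le_one hx.le (dom hx hqx).1 (by omega)))
    (fun x hx hqx => by
      have hd := dom hx hqx
      have hqx0 : 0 ≤ q * x := by positivity
      have hy : 0 < x ^ ℓ := by positivity
      have hy1 : x ^ ℓ ≤ 1 := pow_le_one₀ hx.le hd.1
      rw [vPoly_eq hx, abs_of_nonneg (by
        have : 0 ≤ 1 - q * x := by linarith
        positivity), pow_mul']
      generalize x ^ ℓ = y at *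
      have : (1 + (1 - q * x) * (y⁻¹ + (y ^ 2)⁻¹)) * y ^ 2 = y ^ 2 + (1 - q * x) * (y + 1) := by
        field_simp
      rw [this]
      nlinarith)
  have hG := hasSum_of_functional_equation hq (f := fun x => g x - h' x) (ρ := rPoly q ℓ)
    (σ := sPoly q ℓ) (d := ℓ) (C := 2 * q + 14) (c := 2) (by positivity) (by norm_num)
    (fun x hx hqx => by
      have hd := dom hx hqx
      have hne : 1 - q * x ≠ 0 := by linarith
      have e := heq hx hqx
      have e' := geq hx hqx
      rw [rPoly_eq hx, sPoly_eq hx]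
      simp only [pow_mul', ← hℓ] at e e'
      simp only [hh', hh, hg, pow_mul', pow_right_comm x 2]
      have hy : x ^ ℓ ≠ 0 := by positivity
      generalize x ^ ℓ = y at *
      have hY := mul_inv_cancel₀ hy
      have hD := mul_inv_cancel₀ hne
      simp only [← inv_pow] at e e' ⊢
      generalize y⁻¹ = Y at *
      generalize (1 - q * x)⁻¹ = D at *
      linear_combination (1 - q * x) * (e - e') + (y ^ 2 - wordSum (x ^ 2) (minFramed L) - y ^ 4 +
        wordSum (x ^ 2) (minFramed L ∩ doubleFramed L)) * hD + (1 - q * x) * y ^ 5 * hY)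
    (fun x hx hqx => by
      have hd := dom hx hqx
      have h1 := gb hx hqx
      have h2 := hb' hx hqx
      have h3 : x ^ (2 * ℓ) * x ≤ x ^ (ℓ + 1) := by
        rw [← pow_succ]
        exact pow_le_pow_of_le_one hx.le hd.1 (by omega)
      have h4 : x ^ (4 * ℓ) ≤ x ^ (ℓ + 1) := pow_le_pow_of_le_one hx.le hd.1 (by omega)
      calc |g x - h' x| ≤ |g x| + |h' x| := abs_sub _ _
        _ ≤ 2 * q * x ^ (ℓ + 1) + 14 * x ^ (ℓ + 1) := by
          rw [abs_of_nonneg h1.1]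
          refine add_le_add (h1.2.trans ?_) (h2.trans ?_) <;> gcongr
        _ = _ := by ring)
    (fun x hx hqx => by
      have hd := dom hx hqx
      have hqx0 : 0 ≤ q * x := by positivity
      have hy : 0 < x ^ ℓ := by positivity
      have hy1 : x ^ ℓ ≤ 1 := pow_le_one₀ hx.le hd.1
      rw [sPoly_eq hx, abs_of_nonneg (by
        have : 0 ≤ 1 - q * x := by linarith
        positivity)]
      generalize x ^ ℓ = y at *
      have : (1 + (1 - q * x) * y⁻¹) * y = y + (1 - q * x) := by field_simp
      rw [this]
      linarith)
  simpa [Gterm, Hterm] using hG.add hH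

/-- The words that are minimal framed words for some bifix-free word. -/
def minimalWords (α : Type*) : Set (List α) :=
  {V | ∃ L, (L ≠ [] ∧ BifixFree L) ∧ V ∈ minFramed L}

theorem finite_short_words (q n : ℕ) : {V : List (Fin q) | 2 * V.length < n}.Finite :=
  (List.finite_length_lt (Fin q) n).subset fun V (hV : 2 * V.length < n) =>
    show V.length < n by omega

theorem minimalWords_unique {α : Type*} {U U' W : List α} (hU : U ∈ minimalWords α)
    (hU' : U' ∈ minimalWords α) (h : IsBifix U W) (h' : IsBifix U' W) : U = U' := by
  obtain ⟨L, ⟨hL0, hL⟩, hU⟩ := hU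
  obtain ⟨L', ⟨hL0', hL'⟩, hU'⟩ := hU'
  have hb := isBifix_iff.1 h
  have hb' := isBifix_iff.1 h'
  obtain rfl := bifixFree_unique hL0 hL0' hL hL' (hU.1.1.trans hb.2.1) (hU.1.2.1.trans hb.2.2.1)
    (hU'.1.1.trans hb'.2.1) (hU'.1.2.1.trans hb'.2.2.1)
  exact minFramed_unique hU hU' h h'

theorem ne_nil_of_mem_minimalWords {α : Type*} {V : List α} (h : V ∈ minimalWords α) : V ≠ [] := by
  obtain ⟨L, -, hV⟩ := h
  exact framed_ne_nil hV.1

theorem card_z3Instance (q n : ℕ) :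
    Nat.card {W : List (Fin q) // W.length = n ∧ Z3Instance W} =
      ∑ V ∈ (finite_short_words q n).toFinset,
        (minimalWords (Fin q)).indicator (fun V => q ^ (n - 2 * V.length)) V := by
  classical
  set F := (finite_short_words q n).toFinset.filter (· ∈ minimalWords (Fin q)) with hF
  have hmem {V : List (Fin q)} : V ∈ F ↔ 2 * V.length < n ∧ V ∈ minimalWords (Fin q) := by
    simp [hF]
  let φ : (Σ V : F, {C : List (Fin q) // C.length = n - 2 * V.1.length}) →
      {W : List (Fin q) // W.length = n ∧ Z3Instance W} := fun p =>
    ⟨p.1.1 ++ p.2.1 ++ p.1.1, by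
      have hl := (hmem.1 p.1.2).1
      obtain ⟨L, hL, hV⟩ := (hmem.1 p.1.2).2
      have hlen : (p.1.1 ++ p.2.1 ++ p.1.1).length = n := by
        simp [p.2.2]; omega
      exact ⟨hlen, z3Instance_iff.2
        ⟨L, p.1.1, hL, hV, by simp, List.suffix_append _ _, by omega⟩⟩⟩
  have hφ : Function.Bijective φ := by
    constructor
    · rintro ⟨⟨V, hV⟩, ⟨C, hC⟩⟩ ⟨⟨V', hV'⟩, ⟨C', hC'⟩⟩ h
      have h : V ++ C ++ V = V' ++ C' ++ V' := congrArg Subtype.val h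
      have hm := (hmem.1 hV).2
      have hm' := (hmem.1 hV').2
      obtain rfl := minimalWords_unique hm hm'
        (isBifix_append_middle C (ne_nil_of_mem_minimalWords hm))
        (h ▸ isBifix_append_middle C' (ne_nil_of_mem_minimalWords hm'))
      obtain rfl : C = C' := by simpa using h
      rfl
    · rintro ⟨W, hW, hZ⟩
      obtain ⟨L, V, hL, hV, h1, h2, hl⟩ := z3Instance_iff.1 hZ
      obtain ⟨C, rfl⟩ := eq_append_middle h1 h2 hl.le
      refine ⟨⟨⟨V, hmem.2 ⟨by omega, L, hL, hV⟩⟩, ⟨C, ?_⟩⟩, rfl⟩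
      simp at hW ⊢; omega
  rw [← Nat.card_congr (Equiv.ofBijective φ hφ), Nat.card_sigma]
  simp only [card_words, Set.indicator_apply]
  rw [← Finset.sum_filter, ← hF, Finset.sum_coe_sort F (fun V => q ^ (n - 2 * V.length))]

theorem instProb3_eq_sum {q : ℕ} (hq : q ≠ 0) (n : ℕ) :
    instProb3 q n = ∑ V ∈ (finite_short_words q n).toFinset,
      (minimalWords (Fin q)).indicator (fun V => (((q : ℝ) ^ 2)⁻¹) ^ V.length) V := by
  classical
  rw [instProb3, card_z3Instance, Nat.cast_sum, Finset.sum_div]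
  refine Finset.sum_congr rfl fun V hV => ?_
  have hV : 2 * V.length < n := by simpa using hV
  have hq : (q : ℝ) ≠ 0 := by exact_mod_cast hq
  simp only [Set.indicator_apply]
  split_ifs
  · push_cast
    rw [div_eq_iff (by positivity), inv_pow, ← pow_mul, eq_inv_mul_iff_mul_eq₀ (by positivity),
      ← pow_add]
    congr 1
    omega
  · simp

theorem tendsto_instProb3 {q : ℕ} (hq : 2 ≤ q) :
    Filter.Tendsto (fun n => instProb3 q n) Filter.atTop
      (nhds (wordSum ((q : ℝ) ^ 2)⁻¹ (minimalWords (Fin q)))) := by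
  have hq' : (2 : ℝ) ≤ q := by exact_mod_cast hq
  have h1 : q * ((q : ℝ) ^ 2)⁻¹ < 1 := by
    rw [← div_eq_mul_inv, div_lt_one (by positivity)]
    nlinarith
  have hs := (summable_words (by positivity) h1 (minimalWords (Fin q))).hasSum
  have hs' : HasSum ((minimalWords (Fin q)).indicator fun V => (((q : ℝ) ^ 2)⁻¹) ^ V.length)
      (wordSum ((q : ℝ) ^ 2)⁻¹ (minimalWords (Fin q))) := hasSum_subtype_iff_indicator.1 hs
  have hF : Filter.Tendsto (fun n => (finite_short_words q n).toFinset) Filter.atTop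
      Filter.atTop := by
    refine Filter.tendsto_atTop_finset_of_monotone (fun m n h => ?_)
      fun V => ⟨2 * V.length + 1, by simp⟩
    intro V hV
    simp at hV ⊢; omega
  simp only [instProb3_eq_sum (by omega : q ≠ 0)]
  have h : Filter.Tendsto (fun s => ∑ V ∈ s, (minimalWords (Fin q)).indicator
      (fun V => (((q : ℝ) ^ 2)⁻¹) ^ V.length) V) Filter.atTop
      (nhds (wordSum ((q : ℝ) ^ 2)⁻¹ (minimalWords (Fin q)))) := by
    simpa only [HasSum, SummationFilter.unconditional_filter] using hs'
  exact h.comp hF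

theorem hasSum_wordSum_minFramed {q : ℕ} {x : ℝ} (h0 : 0 ≤ x) (h1 : q * x < 1) :
    HasSum (fun L : {L : List (Fin q) // L ≠ [] ∧ BifixFree L} => wordSum x (minFramed L.1))
      (wordSum x (minimalWords (Fin q))) := by
  let φ : (Σ L : {L : List (Fin q) // L ≠ [] ∧ BifixFree L}, minFramed L.1) →
      minimalWords (Fin q) := fun p => ⟨p.2.1, p.1.1, p.1.2, p.2.2⟩
  have hφ : Function.Bijective φ := by
    constructor
    · rintro ⟨⟨L, hL0, hL⟩, ⟨V, hV⟩⟩ ⟨⟨L', hL0', hL'⟩, ⟨V', hV'⟩⟩ h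
      obtain rfl : V = V' := congrArg Subtype.val h
      obtain rfl := bifixFree_unique hL0 hL0' hL hL' hV.1.1 hV.1.2.1 hV'.1.1 hV'.1.2.1
      rfl
    · rintro ⟨V, L, hL, hV⟩
      exact ⟨⟨⟨L, hL⟩, ⟨V, hV⟩⟩, rfl⟩
  have hs := (summable_words h0 h1 (minimalWords (Fin q))).hasSum
  rw [← (Equiv.ofBijective φ hφ).hasSum_iff] at hs
  exact hs.sigma fun L => (summable_words h0 h1 (minFramed L.1)).hasSum

theorem card_bifixFree_fiber (q ℓ : ℕ) :
    Nat.card ((fun L : {L : List (Fin q) // L ≠ [] ∧ BifixFree L} => L.1.length - 1) ⁻¹' {ℓ}) =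
      aCount q (ℓ + 1) := by
  rw [aCount, if_neg (Nat.succ_ne_zero ℓ)]
  have hlen {L : List (Fin q)} (h0 : L ≠ []) : L.length - 1 = ℓ ↔ L.length = ℓ + 1 := by
    have := List.length_pos_iff.2 h0
    omega
  exact Nat.card_congr
    { toFun := fun L => ⟨L.1.1, (hlen L.1.2.1).1 L.2, L.1.2.2⟩
      invFun := fun L =>
        have h0 : L.1 ≠ [] := List.length_pos_iff.1 (by omega)
        ⟨⟨L.1, h0, L.2.2⟩, (hlen h0).2 L.2.1⟩
      left_inv := fun _ => rfl
      right_inv := fun _ => rfl }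

/-- For `q ≥ 2`, the asymptotic probability of being a `Z₃`-instance exists and
equals `∑_{ℓ≥1} a_ℓ ∑_{i≥0} (G_ℓ(i) + H_ℓ(i))`, all series converging. -/
theorem instProb3_tendsto_GH (q : ℕ) (hq : 2 ≤ q) :
    (∀ ℓ : ℕ, 1 ≤ ℓ → Summable (fun i : ℕ => Gterm q ℓ i + Hterm q ℓ i)) ∧
    Summable (fun ℓ : ℕ =>
      (aCount q (ℓ + 1) : ℝ) * ∑' i : ℕ, (Gterm q (ℓ + 1) i + Hterm q (ℓ + 1) i)) ∧
    Filter.Tendsto (fun n => instProb3 q n) Filter.atTop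
      (nhds (∑' ℓ : ℕ,
        (aCount q (ℓ + 1) : ℝ) * ∑' i : ℕ, (Gterm q (ℓ + 1) i + Hterm q (ℓ + 1) i))) := by
  have hq' : (2 : ℝ) ≤ q := by exact_mod_cast hq
  have h1 : q * ((q : ℝ) ^ 2)⁻¹ < 1 := by
    rw [← div_eq_mul_inv, div_lt_one (by positivity)]
    nlinarith
  have hsum : HasSum (fun ℓ : ℕ =>
      (aCount q (ℓ + 1) : ℝ) * ∑' i : ℕ, (Gterm q (ℓ + 1) i + Hterm q (ℓ + 1) i))
      (wordSum ((q : ℝ) ^ 2)⁻¹ (minimalWords (Fin q))) := by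
    have h := (hasSum_wordSum_minFramed (q := q) (by positivity) h1).tsum_fiberwise
      (fun L => L.1.length - 1)
    refine (congrArg (HasSum · _ _) (funext fun ℓ => ?_)).mpr h
    rw [← card_bifixFree_fiber, ← nsmul_eq_mul, ← tsum_const]
    refine tsum_congr fun L => ?_
    have hl : L.1.1.length = ℓ + 1 := by
      have h0 := List.length_pos_iff.2 L.1.2.1
      have h2 : L.1.1.length - 1 = ℓ := L.2
      omega
    rw [← hl]
    exact (hasSum_Gterm_add_Hterm hq L.1.2.2 L.1.2.1).tsum_eq
  refine ⟨fun ℓ hℓ => ?_, hsum.summable, hsum.tsum_eq ▸ tendsto_instProb3 hq⟩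
  have : Nontrivial (Fin q) := Fin.nontrivial_iff_two_le.2 hq
  obtain ⟨L, hL, hbf⟩ := exists_bifixFree (α := Fin q) (ℓ - 1)
  obtain rfl : L.length = ℓ := by omega
  exact (hasSum_Gterm_add_Hterm hq hbf (List.length_pos_iff.1 (by omega))).summable
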